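/- arXiv:2501.03530 — 3 statements merged into one kernel-verified Lean document; each statement's English description precedes it below -/
import Mathlib

section
/- For every m ∈ {1, 2, 4} and all real numbers a, b, the m-th power of the function f_{y,θ̄} satisfies |f_{y,θ̄}(a)^m − f_{y,θ̄}(b)^m| ≤ m (y + θ̄)^m |a − b|. -/
open Real

theorem stmt4_bound (y θ : ℝ) (hy : 0 ≤ y) (hθ : 0 < θ) (x : ℝ) :
    |(y - exp x) / (1 + exp x / θ)| ≤ y + θ := by
  have he := exp_pos x
  have hd : 0 < 1 + exp x / θ := by positivity
  rw [abs_div, abs_of_pos hd, div_le_iff₀ hd]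
  have h1 : (y + θ) * (1 + exp x / θ) = y + θ + exp x + y * (exp x / θ) := by
    field_simp
    ring
  have h2 : 0 ≤ y * (exp x / θ) := by positivity
  rw [h1, abs_le]
  constructor <;> linarith

theorem stmt4_deriv (y θ : ℝ) (hθ : 0 < θ) (x : ℝ) :
    HasDerivAt (fun x => (y - exp x) / (1 + exp x / θ))
      (-((y + θ) * ((exp x / θ) / (1 + exp x / θ) ^ 2))) x := by
  have he := exp_pos x
  have hd : 0 < 1 + exp x / θ := by positivity
  have h := ((Real.hasDerivAt_exp x).const_sub y).div
    (((Real.hasDerivAt_exp x).div_const θ).const_add 1) hd.ne'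
  refine h.congr_deriv ?_
  field_simp
  ring

theorem stmt4_deriv_bound (y θ : ℝ) (hy : 0 ≤ y) (hθ : 0 < θ) (x : ℝ) :
    |-((y + θ) * ((exp x / θ) / (1 + exp x / θ) ^ 2))| ≤ y + θ := by
  have ht : 0 < exp x / θ := div_pos (exp_pos x) hθ
  generalize exp x / θ = t at ht
  rw [abs_neg, abs_of_nonneg (by positivity)]
  apply mul_le_of_le_one_right (by positivity)
  rw [div_le_one (by positivity)]
  nlinarith

/-- Lipschitz-type bound for powers of the NB GLM working-response function
`f_{y,θ̄}(x) = (y − e^x)/(1 + e^x/θ̄)`: for `m ∈ {1, 2, 4}` and all reals `a, b`,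
`|f_{y,θ̄}(a)^m − f_{y,θ̄}(b)^m| ≤ m (y + θ̄)^m |a − b|`. -/
theorem stmt4 (y θ : ℝ) (hy : 0 ≤ y) (hθ : 0 < θ) :
    ∀ m ∈ ({1, 2, 4} : Set ℕ), ∀ a b : ℝ,
      |((y - exp a) / (1 + exp a / θ)) ^ m - ((y - exp b) / (1 + exp b / θ)) ^ m| ≤
        (m : ℝ) * (y + θ) ^ m * |a - b| := by
  intro m hm a b
  have hm1 : 1 ≤ m := by
    simp only [Set.mem_insert_iff, Set.mem_singleton_iff] at hm
    omega
  have key := Convex.norm_image_sub_le_of_norm_hasDerivWithin_le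
    (f := fun x => ((y - exp x) / (1 + exp x / θ)) ^ m) (C := (m : ℝ) * (y + θ) ^ m)
    (s := Set.univ) (x := b) (y := a)
    (fun x _ => ((stmt4_deriv y θ hθ x).fun_pow m).hasDerivWithinAt) ?_
    convex_univ (Set.mem_univ _) (Set.mem_univ _)
  · simpa only [Real.norm_eq_abs] using key
  · intro x _
    rw [Real.norm_eq_abs, abs_mul, abs_mul, abs_pow, Nat.abs_cast, mul_assoc]
    obtain ⟨k, rfl⟩ : ∃ k, m = k + 1 := ⟨m - 1, by omega⟩
    rw [pow_succ (y + θ), Nat.add_sub_cancel]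
    have h1 := stmt4_bound y θ hy hθ x
    have h2 := stmt4_deriv_bound y θ hy hθ x
    gcongr
end

section
/- Let (Ω, ℱ, ℙ) be a probability space, let Z : Ω → ℝ^p be a measurable random vector with ‖Z‖ ≤ C almost surely for some constant C > 0, and suppose the p × p matrix 𝔼[Z Zᵀ] is invertible. Let θ̄ > 0 and β ∈ ℝ^p, and define the random variable W = exp(βᵀZ)/(1 + exp(βᵀZ)/θ̄). Then the matrix 𝔼[W · Z Zᵀ] is positive definite; in particular it is invertible. -/
open MeasureTheory Real

/-- Invertibility of the NB GLM information matrix: if `Z` is an a.s.-bounded random vector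
in `ℝ^p` with `𝔼[Z Zᵀ]` invertible, and `W = exp(βᵀZ)/(1 + exp(βᵀZ)/θ̄)`, then the matrix
`𝔼[W · Z Zᵀ]` is positive definite; in particular it is invertible. -/
theorem stmt5 {Ω : Type*} [MeasurableSpace Ω] (μ : Measure Ω) [IsProbabilityMeasure μ]
    {p : ℕ} (Z : Ω → EuclideanSpace ℝ (Fin p)) (hZmeas : Measurable Z)
    (C : ℝ) (hC : 0 < C) (hbound : ∀ᵐ ω ∂μ, ‖Z ω‖ ≤ C)
    (hinv : IsUnit (Matrix.of (fun i j => ∫ ω, Z ω i * Z ω j ∂μ) :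
      Matrix (Fin p) (Fin p) ℝ).det)
    (θ : ℝ) (hθ : 0 < θ) (β : EuclideanSpace ℝ (Fin p)) :
    (Matrix.of (fun i j => ∫ ω,
        (exp (∑ l, β l * Z ω l) / (1 + exp (∑ l, β l * Z ω l) / θ)) * Z ω i * Z ω j ∂μ) :
      Matrix (Fin p) (Fin p) ℝ).PosDef ∧
    IsUnit (Matrix.of (fun i j => ∫ ω,
        (exp (∑ l, β l * Z ω l) / (1 + exp (∑ l, β l * Z ω l) / θ)) * Z ω i * Z ω j ∂μ) :
      Matrix (Fin p) (Fin p) ℝ).det := by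
  set W : Ω → ℝ := fun ω => exp (∑ l, β l * Z ω l) / (1 + exp (∑ l, β l * Z ω l) / θ) with hW
  have hZi : ∀ i, Measurable fun ω => Z ω i := fun i => by fun_prop
  have hWmeas : Measurable W := by fun_prop
  have hWpos : ∀ ω, 0 < W ω := fun ω => by positivity
  have hWle : ∀ ω, W ω ≤ θ := fun ω => by
    have he := exp_pos (∑ l, β l * Z ω l)
    simp only [hW]
    rw [div_le_iff₀ (by positivity)]
    have : θ * (1 + exp (∑ l, β l * Z ω l) / θ) = θ + exp (∑ l, β l * Z ω l) := by
      field_simp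
    linarith
  have hbi : ∀ᵐ ω ∂μ, ∀ i, |Z ω i| ≤ C := by
    filter_upwards [hbound] with ω h i
    exact (PiLp.norm_apply_le (Z ω) i).trans h
  have hint0 : ∀ i j, Integrable (fun ω => Z ω i * Z ω j) μ := fun i j => by
    refine Integrable.of_bound ((hZi i).mul (hZi j)).aestronglyMeasurable (C * C) ?_
    filter_upwards [hbi] with ω h
    rw [norm_eq_abs, abs_mul]
    exact mul_le_mul (h i) (h j) (abs_nonneg _) hC.le
  have hint : ∀ i j, Integrable (fun ω => W ω * Z ω i * Z ω j) μ := fun i j => by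
    refine Integrable.of_bound ((hWmeas.mul (hZi i)).mul (hZi j)).aestronglyMeasurable
      (θ * C * C) ?_
    filter_upwards [hbi] with ω h
    rw [norm_eq_abs, abs_mul, abs_mul, abs_of_pos (hWpos ω)]
    have h1 := mul_le_mul (hWle ω) (h i) (abs_nonneg _) hθ.le
    exact mul_le_mul h1 (h j) (abs_nonneg _) (by positivity)
  have hPD : (Matrix.of (fun i j => ∫ ω, W ω * Z ω i * Z ω j ∂μ) :
      Matrix (Fin p) (Fin p) ℝ).PosDef := by
    refine Matrix.PosDef.of_dotProduct_mulVec_pos ?_ ?_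
    · ext i j
      simp only [Matrix.conjTranspose_apply, Matrix.of_apply, star_trivial]
      exact integral_congr_ae (Filter.Eventually.of_forall fun ω => by ring)
    intro x hx
    have hpt : ∀ ω, W ω * (∑ i, x i * Z ω i) ^ 2
        = ∑ i, ∑ j, x i * x j * (W ω * Z ω i * Z ω j) := fun ω => by
      rw [sq, Finset.sum_mul_sum, Finset.mul_sum]
      refine Finset.sum_congr rfl fun i _ => ?_
      rw [Finset.mul_sum]
      exact Finset.sum_congr rfl fun j _ => by ring
    have hI : Integrable (fun ω => W ω * (∑ i, x i * Z ω i) ^ 2) μ := by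
      simp only [hpt]
      exact integrable_finsetSum _ fun i _ => integrable_finsetSum _ fun j _ =>
        (hint i j).const_mul _
    have hq : star x ⬝ᵥ (Matrix.of (fun i j => ∫ ω, W ω * Z ω i * Z ω j ∂μ)).mulVec x
        = ∫ ω, W ω * (∑ i, x i * Z ω i) ^ 2 ∂μ := by
      simp only [hpt]
      rw [integral_finsetSum _ fun i _ => integrable_finsetSum _ fun j _ =>
        (hint i j).const_mul _]
      simp only [dotProduct, Matrix.mulVec, Matrix.of_apply, star_trivial]
      refine Finset.sum_congr rfl fun i _ => ?_
      rw [integral_finsetSum _ fun j _ => (hint i j).const_mul _, Finset.mul_sum]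
      refine Finset.sum_congr rfl fun j _ => ?_
      rw [integral_const_mul]
      ring
    rw [hq]
    have hnn : ∀ ω, 0 ≤ W ω * (∑ i, x i * Z ω i) ^ 2 :=
      fun ω => mul_nonneg (hWpos ω).le (sq_nonneg _)
    refine lt_of_le_of_ne (integral_nonneg hnn) fun h0 => hx ?_
    have hae := (integral_eq_zero_iff_of_nonneg hnn hI).1 h0.symm
    have hA : (Matrix.of (fun i j => ∫ ω, Z ω i * Z ω j ∂μ)).mulVec x = 0 := by
      ext i
      simp only [dotProduct, Matrix.mulVec, Matrix.of_apply, Pi.zero_apply]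
      simp only [← integral_mul_const]
      rw [← integral_finsetSum _ fun j _ => (hint0 i j).mul_const _]
      refine integral_eq_zero_of_ae ?_
      filter_upwards [hae] with ω h
      have hs : ∑ i, x i * Z ω i = 0 := by
        simpa [(hWpos ω).ne'] using h
      calc ∑ j, Z ω i * Z ω j * x j = Z ω i * ∑ j, x j * Z ω j := by
            rw [Finset.mul_sum]
            exact Finset.sum_congr rfl fun j _ => by ring
        _ = 0 := by rw [hs, mul_zero]
    exact Matrix.eq_zero_of_mulVec_eq_zero hinv.ne_zero hA
  exact ⟨hPD, (Matrix.isUnit_iff_isUnit_det _).1 hPD.isUnit⟩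
end

section
/- Let n ≥ 2 and let c, x ∈ ℝ^n be fixed vectors. Let π be a uniformly random permutation of {1, …, n}, and define S = (1/n) Σ_{i=1}^n c_i x_{π(i)}. Then 𝔼[S] = ((1/n) Σ_{i=1}^n c_i)((1/n) Σ_{i=1}^n x_i) and Var[S] = (1/(n−1)) · ((1/n) Σ_{i=1}^n c_i² − ((1/n) Σ_{i=1}^n c_i)²) · ((1/n) Σ_{i=1}^n x_i² − ((1/n) Σ_{i=1}^n x_i)²); in particular Var[S] ≤ (1/(n−1)) ((1/n) Σ_{i=1}^n c_i²)((1/n) Σ_{i=1}^n x_i²). -/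
/-- `S π = (1/n) ∑ᵢ cᵢ x_{π(i)}`, the randomly permuted inner product. -/
noncomputable def permStat (n : ℕ) (c x : Fin n → ℝ) (π : Equiv.Perm (Fin n)) : ℝ :=
  (1 / (n : ℝ)) * ∑ i, c i * x (π i)

/-- The mean of `S` under a uniformly random permutation `π`. -/
noncomputable def permMean (n : ℕ) (c x : Fin n → ℝ) : ℝ :=
  (∑ π : Equiv.Perm (Fin n), permStat n c x π) / (Fintype.card (Equiv.Perm (Fin n)) : ℝ)

/-- The variance of `S` under a uniformly random permutation `π`. -/
noncomputable def permVar (n : ℕ) (c x : Fin n → ℝ) : ℝ :=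
  (∑ π : Equiv.Perm (Fin n), (permStat n c x π - permMean n c x) ^ 2) /
    (Fintype.card (Equiv.Perm (Fin n)) : ℝ)

open Finset in
lemma perm_sum_one (n : ℕ) (f : Fin n → ℝ) (i : Fin n) :
    (n : ℝ) * ∑ π : Equiv.Perm (Fin n), f (π i)
      = (Fintype.card (Equiv.Perm (Fin n)) : ℝ) * ∑ k, f k := by
  have h : ∀ j, ∑ π : Equiv.Perm (Fin n), f (π j) = ∑ π : Equiv.Perm (Fin n), f (π i) := by
    intro j
    refine Fintype.sum_equiv (Equiv.mulRight (Equiv.swap i j)) _ _ ?_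
    intro π
    simp
  have h2 : ∑ j : Fin n, ∑ π : Equiv.Perm (Fin n), f (π j)
      = (n : ℝ) * ∑ π : Equiv.Perm (Fin n), f (π i) := by
    rw [Finset.sum_congr rfl (fun j _ => h j)]
    simp
  rw [← h2, Finset.sum_comm, Finset.sum_congr rfl (fun π _ => Equiv.sum_comp π f)]
  simp

lemma perm_sum_two (n : ℕ) (x : Fin n → ℝ) (i j : Fin n) (hij : j ≠ i) :
    (n : ℝ) * ((n : ℝ) - 1) * ∑ π : Equiv.Perm (Fin n), x (π i) * x (π j)
      = (Fintype.card (Equiv.Perm (Fin n)) : ℝ) * ((∑ k, x k) ^ 2 - ∑ k, x k ^ 2) := by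
  have h : ∀ k ∈ Finset.univ.erase i, ∑ π : Equiv.Perm (Fin n), x (π i) * x (π k)
      = ∑ π : Equiv.Perm (Fin n), x (π i) * x (π j) := by
    intro k hk
    have hk' : k ≠ i := Finset.ne_of_mem_erase hk
    refine Fintype.sum_equiv (Equiv.mulRight (Equiv.swap j k)) _ _ ?_
    intro π
    simp [Equiv.swap_apply_of_ne_of_ne hij.symm hk'.symm]
  have hn : 1 ≤ n := by have := i.isLt; omega
  have h2 : ∑ k ∈ Finset.univ.erase i, ∑ π : Equiv.Perm (Fin n), x (π i) * x (π k)
      = ((n : ℝ) - 1) * ∑ π : Equiv.Perm (Fin n), x (π i) * x (π j) := by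
    rw [Finset.sum_congr rfl h]
    simp [Finset.card_erase_of_mem, Nat.cast_sub hn]
  have h3 : ∑ k : Fin n, ∑ π : Equiv.Perm (Fin n), x (π i) * x (π k)
      = (∑ k, x k) * ∑ π : Equiv.Perm (Fin n), x (π i) := by
    rw [Finset.sum_comm, Finset.mul_sum]
    refine Finset.sum_congr rfl fun π _ => ?_
    rw [← Finset.mul_sum, Equiv.sum_comp π x, mul_comm]
  have h4 := Finset.add_sum_erase Finset.univ
    (fun k => ∑ π : Equiv.Perm (Fin n), x (π i) * x (π k)) (Finset.mem_univ i)
  simp only [h2, h3] at h4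
  have h5 := perm_sum_one n x i
  have h6 := perm_sum_one n (fun k => x k * x k) i
  simp only [pow_two (x _)]
  linear_combination (n : ℝ) * h4 + (∑ k, x k) * h5 - h6

lemma perm_sum_sq (n : ℕ) (hn : 2 ≤ n) (c x : Fin n → ℝ) :
    (n : ℝ) * ((n : ℝ) - 1) * ∑ π : Equiv.Perm (Fin n), (∑ i, c i * x (π i)) ^ 2
      = (Fintype.card (Equiv.Perm (Fin n)) : ℝ) *
        (((∑ k, c k) ^ 2 - ∑ k, c k ^ 2) * ((∑ k, x k) ^ 2 - ∑ k, x k ^ 2)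
          + ((n : ℝ) - 1) * (∑ k, c k ^ 2) * ∑ k, x k ^ 2) := by
  set N := (Fintype.card (Equiv.Perm (Fin n)) : ℝ) with hN
  set X := (∑ k, x k) ^ 2 - ∑ k, x k ^ 2 with hX
  set Q := ∑ k, x k ^ 2 with hQ
  have hT : ∀ i j, (n : ℝ) * ((n : ℝ) - 1) * ∑ π : Equiv.Perm (Fin n), x (π i) * x (π j)
      = N * X + (if i = j then N * (((n : ℝ) - 1) * Q - X) else 0) := by
    intro i j
    by_cases hij : i = j
    · subst hij
      have := perm_sum_one n (fun k => x k ^ 2) i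
      simp only [← pow_two, if_true]
      linear_combination ((n : ℝ) - 1) * this
    · rw [if_neg hij, perm_sum_two n x i j (Ne.symm hij), add_zero]
  have h1 : ∑ π : Equiv.Perm (Fin n), (∑ i, c i * x (π i)) ^ 2
      = ∑ i, ∑ j, c i * c j * ∑ π : Equiv.Perm (Fin n), x (π i) * x (π j) := by
    simp only [pow_two, Finset.sum_mul_sum]
    simp only [Finset.mul_sum]
    rw [Finset.sum_comm]
    refine Finset.sum_congr rfl fun i _ => ?_
    rw [Finset.sum_comm]
    refine Finset.sum_congr rfl fun j _ => Finset.sum_congr rfl fun π _ => by ring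
  have h2 : (n : ℝ) * ((n : ℝ) - 1) *
        ∑ i, ∑ j, c i * c j * ∑ π : Equiv.Perm (Fin n), x (π i) * x (π j)
      = ∑ i, ∑ j, (c i * c j * (N * X)
          + (if i = j then c i * c j * (N * (((n : ℝ) - 1) * Q - X)) else 0)) := by
    rw [Finset.mul_sum]
    refine Finset.sum_congr rfl fun i _ => ?_
    rw [Finset.mul_sum]
    refine Finset.sum_congr rfl fun j _ => ?_
    have := hT i j
    split_ifs at this ⊢ <;> linear_combination (c i * c j) * this
  rw [h1, h2]
  simp only [Finset.sum_add_distrib, Finset.sum_ite_eq, Finset.mem_univ, if_true,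
    ← Finset.sum_mul, ← Finset.mul_sum, ← pow_two]
  ring

theorem perm_mean_eq (n : ℕ) (hn : 2 ≤ n) (c x : Fin n → ℝ) :
    permMean n c x = ((1 / (n : ℝ)) * ∑ i, c i) * ((1 / (n : ℝ)) * ∑ i, x i) := by
  have hn0 : (n : ℝ) ≠ 0 := by positivity
  have hN : (Fintype.card (Equiv.Perm (Fin n)) : ℝ) ≠ 0 := by
    exact_mod_cast Fintype.card_ne_zero
  have h : (n : ℝ) * ∑ π : Equiv.Perm (Fin n), ∑ i, c i * x (π i)
      = (Fintype.card (Equiv.Perm (Fin n)) : ℝ) * ((∑ i, c i) * ∑ i, x i) := by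
    rw [Finset.sum_comm, Finset.mul_sum, Finset.sum_mul, Finset.mul_sum]
    refine Finset.sum_congr rfl fun i _ => ?_
    rw [← Finset.mul_sum]
    linear_combination c i * perm_sum_one n x i
  unfold permMean permStat
  rw [← Finset.mul_sum, div_eq_iff hN]
  field_simp
  linear_combination h

theorem perm_var_eq (n : ℕ) (hn : 2 ≤ n) (c x : Fin n → ℝ) :
    permVar n c x = (1 / ((n : ℝ) - 1)) *
      ((1 / (n : ℝ)) * ∑ i, c i ^ 2 - ((1 / (n : ℝ)) * ∑ i, c i) ^ 2) *
      ((1 / (n : ℝ)) * ∑ i, x i ^ 2 - ((1 / (n : ℝ)) * ∑ i, x i) ^ 2) := by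
  have hn0 : (n : ℝ) ≠ 0 := by positivity
  have hn1 : (n : ℝ) - 1 ≠ 0 := by
    have : (2 : ℝ) ≤ n := by exact_mod_cast hn
    linarith
  have hN : (Fintype.card (Equiv.Perm (Fin n)) : ℝ) ≠ 0 := by
    exact_mod_cast Fintype.card_ne_zero
  have hm : ∑ π : Equiv.Perm (Fin n), permStat n c x π
      = permMean n c x * (Fintype.card (Equiv.Perm (Fin n)) : ℝ) := by
    unfold permMean
    field_simp
  have hs := perm_sum_sq n hn c x
  have hs2 : ∑ π : Equiv.Perm (Fin n), permStat n c x π ^ 2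
      = (1 / (n : ℝ)) ^ 2 * ∑ π : Equiv.Perm (Fin n), (∑ i, c i * x (π i)) ^ 2 := by
    simp only [permStat, mul_pow, ← Finset.mul_sum]
  have hv : ∑ π : Equiv.Perm (Fin n), (permStat n c x π - permMean n c x) ^ 2
      = ∑ π : Equiv.Perm (Fin n), permStat n c x π ^ 2
        - permMean n c x ^ 2 * (Fintype.card (Equiv.Perm (Fin n)) : ℝ) := by
    have : ∀ π : Equiv.Perm (Fin n), (permStat n c x π - permMean n c x) ^ 2
        = permStat n c x π ^ 2 - (2 * permMean n c x) * permStat n c x π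
          + permMean n c x ^ 2 := fun π => by ring
    simp only [this, Finset.sum_add_distrib, Finset.sum_sub_distrib, ← Finset.mul_sum, hm,
      Finset.sum_const, Finset.card_univ, nsmul_eq_mul]
    ring
  have hs3 : ∑ π : Equiv.Perm (Fin n), (∑ i, c i * x (π i)) ^ 2
      = (Fintype.card (Equiv.Perm (Fin n)) : ℝ) *
        (((∑ k, c k) ^ 2 - ∑ k, c k ^ 2) * ((∑ k, x k) ^ 2 - ∑ k, x k ^ 2)
          + ((n : ℝ) - 1) * (∑ k, c k ^ 2) * ∑ k, x k ^ 2) / ((n : ℝ) * ((n : ℝ) - 1)) := by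
    rw [eq_div_iff (mul_ne_zero hn0 hn1), ← hs]
    ring
  unfold permVar
  rw [hv, hs2, hs3, perm_mean_eq n hn, div_eq_iff hN]
  generalize ∑ k, c k = C
  generalize ∑ k, x k = X
  generalize ∑ k, c k ^ 2 = C2
  generalize ∑ k, x k ^ 2 = X2
  field_simp
  ring

lemma var_nonneg_aux (n : ℕ) (hn : 2 ≤ n) (c : Fin n → ℝ) :
    0 ≤ (1 / (n : ℝ)) * ∑ i, c i ^ 2 - ((1 / (n : ℝ)) * ∑ i, c i) ^ 2 := by
  have hn0 : (0 : ℝ) < n := by positivity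
  have h := sq_sum_le_card_mul_sum_sq (s := Finset.univ) (f := c)
  simp only [Finset.card_univ, Fintype.card_fin] at h
  have : (1 / (n : ℝ)) * ∑ i, c i ^ 2 - ((1 / (n : ℝ)) * ∑ i, c i) ^ 2
      = ((n : ℝ) * ∑ i, c i ^ 2 - (∑ i, c i) ^ 2) / (n : ℝ) ^ 2 := by
    field_simp
  rw [this]
  exact div_nonneg (by linarith) (by positivity)

/-- Hoeffding's identity for randomly permuted inner products: for `S = (1/n) ∑ᵢ cᵢ x_{π(i)}`
with `π` a uniformly random permutation of `{1, …, n}`,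
`𝔼[S] = ((1/n) ∑ cᵢ)((1/n) ∑ xᵢ)` and
`Var[S] = (1/(n−1)) ((1/n) ∑ cᵢ² − ((1/n) ∑ cᵢ)²)((1/n) ∑ xᵢ² − ((1/n) ∑ xᵢ)²)`;
in particular `Var[S] ≤ (1/(n−1)) ((1/n) ∑ cᵢ²)((1/n) ∑ xᵢ²)`. -/
theorem stmt7 (n : ℕ) (hn : 2 ≤ n) (c x : Fin n → ℝ) :
    permMean n c x = ((1 / (n : ℝ)) * ∑ i, c i) * ((1 / (n : ℝ)) * ∑ i, x i) ∧
    permVar n c x = (1 / ((n : ℝ) - 1)) *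
      ((1 / (n : ℝ)) * ∑ i, c i ^ 2 - ((1 / (n : ℝ)) * ∑ i, c i) ^ 2) *
      ((1 / (n : ℝ)) * ∑ i, x i ^ 2 - ((1 / (n : ℝ)) * ∑ i, x i) ^ 2) ∧
    permVar n c x ≤ (1 / ((n : ℝ) - 1)) *
      ((1 / (n : ℝ)) * ∑ i, c i ^ 2) * ((1 / (n : ℝ)) * ∑ i, x i ^ 2) := by
  refine ⟨perm_mean_eq n hn c x, perm_var_eq n hn c x, ?_⟩
  rw [perm_var_eq n hn c x]
  have hn1 : (0 : ℝ) ≤ 1 / ((n : ℝ) - 1) := by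
    have : (2 : ℝ) ≤ n := by exact_mod_cast hn
    exact div_nonneg zero_le_one (by linarith)
  have hc := var_nonneg_aux n hn c
  have hx := var_nonneg_aux n hn x
  rw [mul_assoc, mul_assoc]
  refine mul_le_mul_of_nonneg_left (mul_le_mul ?_ ?_ hx ?_) hn1
  · exact sub_le_self _ (sq_nonneg _)
  · exact sub_le_self _ (sq_nonneg _)
  · exact mul_nonneg (by positivity) (Finset.sum_nonneg fun i _ => sq_nonneg _)
end
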